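/- arXiv:1507.02745 — 9 statements merged into one kernel-verified Lean document; each statement's English description precedes it below -/
import Mathlib

section
/- Let C be a field, K a subfield of C, and I a subset of C satisfying: (i) 0 ∈ I and I ≠ {0}; (ii) I contains no nonzero element of K; (iii) I is an additive subgroup of C; (iv) a·I ⊆ I for every a ∈ K; (v) I·I ⊆ I; (vi) the complement C ∖ I is closed under multiplication. Then the set O := {x ∈ C : x·I ⊆ I} is a valuation subring of C containing K, the set I is exactly the set of non-units of O (equivalently, I is the maximal ideal of O), and 1 + I is closed under inversion: for every x ∈ I the element 1 + x is invertible in C and (1 + x)⁻¹ ∈ 1 + I. -/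
/-- conditions 1–7 on a type-definable set `I` make
`O := {x | x·I ⊆ I}` a valuation ring containing `K`, whose set of
non-units is exactly `I`, and `(1 + I)⁻¹ = 1 + I`. -/
theorem stmt_0 {C : Type*} [Field C] (K : Subfield C) (I : Set C)
    (h0 : (0 : C) ∈ I) (hne : I ≠ {0})
    (hK0 : ∀ x ∈ I, x ∈ K → x = 0)
    (hsub : ∀ x ∈ I, ∀ y ∈ I, x - y ∈ I)
    (hKmul : ∀ a ∈ K, ∀ x ∈ I, a * x ∈ I)
    (hmul : ∀ x ∈ I, ∀ y ∈ I, x * y ∈ I)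
    (hcompl : ∀ x y : C, x ∉ I → y ∉ I → x * y ∉ I) :
    ∃ O : ValuationSubring C,
      (O : Set C) = {x : C | ∀ y ∈ I, x * y ∈ I} ∧
      (K : Set C) ⊆ (O : Set C) ∧
      I = {x : C | x ∈ O ∧ ¬ ∃ y ∈ O, x * y = 1} ∧
      (∀ x ∈ I, ∃ y ∈ I, (1 + x) * (1 + y) = 1) := by
  have neg_mem : ∀ x ∈ I, -x ∈ I := fun x hx => by simpa using hsub 0 h0 x hx
  have add_mem : ∀ x ∈ I, ∀ y ∈ I, x + y ∈ I := fun x hx y hy => by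
    simpa using hsub x hx (-y) (neg_mem y hy)
  have one_notMem : (1 : C) ∉ I := fun h => one_ne_zero (hK0 1 h K.one_mem)
  have ne_zero : ∀ x ∉ I, x ≠ 0 := fun x hx h => hx (h ▸ h0)
  have inv_mul_mem : ∀ x ∉ I, ∀ y ∈ I, x⁻¹ * y ∈ I := fun x hx y hy => by
    by_contra h
    refine hcompl x _ hx h ?_
    rwa [mul_inv_cancel_left₀ (ne_zero x hx)]
  let O : ValuationSubring C :=
    { carrier := {x : C | ∀ y ∈ I, x * y ∈ I}
      mul_mem' := fun {a b} ha hb y hy => by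
        rw [mul_assoc]
        exact ha _ (hb y hy)
      one_mem' := fun y hy => by rwa [one_mul]
      add_mem' := fun {a b} ha hb y hy => by
        rw [add_mul]
        exact add_mem _ (ha y hy) _ (hb y hy)
      zero_mem' := fun y _ => by rwa [zero_mul]
      neg_mem' := fun {a} ha y hy => by
        rw [neg_mul]
        exact neg_mem _ (ha y hy)
      mem_or_inv_mem' := fun x => by
        by_cases hx : x ∈ I
        · exact Or.inl (hmul x hx)
        · exact Or.inr (inv_mul_mem x hx) }
  refine ⟨O, rfl, hKmul, ?_, ?_⟩
  · ext x
    constructor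
    · rintro hx
      refine ⟨hmul x hx, ?_⟩
      rintro ⟨y, hy, hxy⟩
      apply one_notMem
      rw [← hxy, mul_comm]
      exact hy x hx
    · rintro ⟨-, hx⟩
      by_contra h
      exact hx ⟨x⁻¹, inv_mul_mem x h, mul_inv_cancel₀ (ne_zero x h)⟩
  · intro x hx
    have hx1 : 1 + x ∉ I := fun h => one_notMem (by simpa using hsub _ h x hx)
    refine ⟨(1 + x)⁻¹ * -x, inv_mul_mem _ hx1 _ (neg_mem x hx), ?_⟩
    rw [mul_add, mul_inv_cancel_left₀ (ne_zero _ hx1)]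
    ring
end

section
/- Let K be a field and let A ⊆ B be two valuation subrings of K, with m_B the maximal ideal of B. Then m_B ⊆ A, the image Ā of A under the residue map B → B/m_B is a valuation subring of the residue field B/m_B, and A is a henselian local ring if and only if both B is a henselian local ring and Ā is a henselian local ring. -/
open Polynomial IsLocalRing

/-- If the maximal ideal of `S` lies in the image of a henselian local ring `R`, then `S` is
henselian. This covers both quotients of `R` and coarsenings of valuation rings. -/
theorem HenselianLocalRing.of_maximalIdeal_le_range {R S : Type*} [CommRing R] [CommRing S]
    [IsLocalRing S] [HenselianLocalRing R] (φ : R →+* S)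
    (hφ : ∀ s ∈ maximalIdeal S, ∃ r, φ r = s) : HenselianLocalRing S where
  is_henselian f hf b hb hb' := by
    have hdeg : f.natDegree ≠ 0 := by
      intro h
      rw [hf.natDegree_eq_zero.mp h] at hb'
      simp at hb'
    obtain ⟨m, hm⟩ := Nat.exists_eq_succ_of_ne_zero hdeg
    obtain ⟨u, hu⟩ := hb'.exists_right_inv
    set g := taylor b f with hg
    have hg0 : g.coeff 0 = f.eval b := taylor_coeff_zero ..
    have hg1 : g.coeff 1 = f.derivative.eval b := taylor_coeff_one ..
    -- Substituting `X = g₀ u Y` and dividing by `g₀` turns `g` into `1 + Y + ∑ hᵢ Yⁱ⁺²`, with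
    -- `hᵢ` in the maximal ideal; its reciprocal polynomial is monic with `-1` as simple root.
    have hlift (i : ℕ) : ∃ r ∈ maximalIdeal R,
        φ r = g.coeff (i + 2) * f.eval b ^ (i + 1) * u ^ (i + 2) := by
      have hmem : g.coeff (i + 2) * f.eval b ^ (i + 1) * u ^ (i + 2) ∈ maximalIdeal S :=
        Ideal.mul_mem_right _ _ <| Ideal.mul_mem_left _ _ <|
          Ideal.pow_mem_of_mem _ hb _ i.succ_pos
      obtain ⟨r, hr⟩ := hφ _ hmem
      refine ⟨r, fun h ↦ ?_, hr⟩
      exact hmem (hr ▸ h.map φ)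
    choose h hmax hh using hlift
    set q : R[X] := ∑ i ∈ Finset.range m, C (h i) * X ^ (m - 1 - i) with hq
    have hqdeg : q.degree ≤ m := by
      refine (degree_sum_le _ _).trans (Finset.sup_le fun i _ ↦ (degree_C_mul_X_pow_le _ _).trans ?_)
      exact_mod_cast (by omega : m - 1 - i ≤ m)
    have hmonic : (X ^ (m + 1) + (X ^ m + q)).Monic :=
      monic_X_pow_add (((degree_add_le _ _).trans (max_le (degree_X_pow_le m) hqdeg)).trans_lt
        (by exact_mod_cast m.lt_succ_self))
    have hqmap : q.map (residue R) = 0 := by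
      simp [hq, Polynomial.map_sum, (residue_eq_zero_iff _).mpr (hmax _)]
    have hpmap : (X ^ (m + 1) + (X ^ m + q)).map (residue R) = X ^ (m + 1) + X ^ m := by
      simp [hqmap]
    obtain ⟨z, hz, hz1⟩ := HenselianLocalRing.is_henselian _ hmonic (-1)
      (by
        rw [← residue_eq_zero_iff, ← eval_map_apply, hpmap]
        simp [pow_succ])
      (by
        rw [← residue_ne_zero_iff_isUnit, ← eval_map_apply, ← derivative_map, hpmap]
        cases m with
        | zero => simp
        | succ m =>
          have : eval (residue R (-1)) (derivative (X ^ (m + 1 + 1) + X ^ (m + 1))) =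
              (-1) ^ (m + 1) := by
            simp [pow_succ]
            ring
          rw [this]
          exact pow_ne_zero _ (neg_ne_zero.mpr one_ne_zero))
    have hzu : IsUnit z := by
      rw [← residue_ne_zero_iff_isUnit]
      have := (residue_eq_zero_iff _).mpr hz1
      rw [map_sub, sub_eq_zero] at this
      simp [this]
    obtain ⟨y, hy⟩ := hzu.exists_right_inv
    have hroot : 1 + y + ∑ i ∈ Finset.range m, h i * y ^ (i + 2) = 0 := by
      have key : y ^ (m + 1) * eval z (X ^ (m + 1) + (X ^ m + q)) = 0 := by
        rw [hz.eq_zero, mul_zero]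
      rw [← key, hq]
      simp only [eval_add, eval_pow, eval_X, eval_finsetSum, eval_mul, eval_C, mul_add,
        Finset.mul_sum]
      rw [← mul_pow, mul_comm y z, hy, one_pow, pow_succ y m, mul_right_comm, ← mul_pow,
        mul_comm y z, hy, one_pow, one_mul, add_assoc]
      congr 2
      refine Finset.sum_congr rfl fun i hi ↦ ?_
      rw [Finset.mem_range] at hi
      obtain ⟨k, rfl⟩ : ∃ k, m = k + i + 1 := ⟨m - 1 - i, by omega⟩
      have e : k + i + 1 - 1 - i = k := by omega
      rw [e]
      have hyz : y ^ k * z ^ k = 1 := by rw [← mul_pow, mul_comm, hy, one_pow]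
      linear_combination (-(h i) * y ^ (i + 2)) * hyz
    refine ⟨b + f.eval b * u * φ y, ?_, ?_⟩
    · have hrootφ := congrArg φ hroot
      simp only [map_add, map_one, map_sum, map_mul, map_pow, hh, map_zero] at hrootφ
      have htaylor : f.eval (b + f.eval b * u * φ y) = g.eval (f.eval b * u * φ y) := by
        rw [hg, taylor_eval, add_comm]
      rw [IsRoot.def, htaylor, eval_eq_sum_range, hg, natDegree_taylor, hm,
        Finset.sum_range_succ', Finset.sum_range_succ', ← hg, zero_add, hg0, hg1]
      have hsum : ∑ i ∈ Finset.range m, g.coeff (i + 1 + 1) * (f.eval b * u * φ y) ^ (i + 1 + 1) =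
          f.eval b * ∑ i ∈ Finset.range m,
            g.coeff (i + 2) * f.eval b ^ (i + 1) * u ^ (i + 2) * φ y ^ (i + 2) := by
        rw [Finset.mul_sum]
        exact Finset.sum_congr rfl fun i _ ↦ by ring
      rw [hsum]
      linear_combination f.eval b * hrootφ + f.eval b * φ y * hu
    · rw [add_sub_cancel_left, mul_assoc]
      exact Ideal.mul_mem_right _ _ hb

/-- A local ring `R` is henselian if it embeds in a henselian local ring `S` in such a way that the
maximal ideal of `S` is the kernel of a surjection of `R` onto a henselian local ring `T`. -/
theorem HenselianLocalRing.of_injective_of_surjective {R S T : Type*} [CommRing R] [CommRing S]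
    [CommRing T] [IsLocalRing R] [HenselianLocalRing S] [HenselianLocalRing T]
    (φ : R →+* S) (ψ : R →+* T) (hφ : Function.Injective φ) (hψ : Function.Surjective ψ)
    (hrange : ∀ s ∈ maximalIdeal S, ∃ r, φ r = s)
    (hker : ∀ r, ψ r = 0 ↔ φ r ∈ maximalIdeal S) : HenselianLocalRing R where
  is_henselian f hf a ha ha' := by
    have : IsLocalHom ψ := hψ.isLocalHom
    have hψmem (r : R) : ψ r ∈ maximalIdeal T ↔ r ∈ maximalIdeal R := by
      simp [mem_maximalIdeal, mem_nonunits_iff]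
    obtain ⟨t, ht, hta⟩ := HenselianLocalRing.is_henselian (f.map ψ) (hf.map ψ) (ψ a)
      (by rwa [eval_map_apply, hψmem])
      (by rw [derivative_map, eval_map_apply]; exact ha'.map ψ)
    obtain ⟨c, rfl⟩ := hψ t
    rw [← map_sub, hψmem] at hta
    rw [IsRoot.def, eval_map_apply, hker] at ht
    have hc : IsUnit (f.derivative.eval c) := by
      have hres := (residue_eq_zero_iff _).mpr hta
      rw [map_sub, sub_eq_zero] at hres
      rw [← residue_ne_zero_iff_isUnit] at ha' ⊢
      rwa [← eval_map_apply, hres, eval_map_apply]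
    obtain ⟨s, hs, hsc⟩ := HenselianLocalRing.is_henselian (f.map φ) (hf.map φ) (φ c)
      (by rwa [eval_map_apply])
      (by rw [derivative_map, eval_map_apply]; exact hc.map φ)
    obtain ⟨d, hd⟩ := hrange _ hsc
    have hdmem : d ∈ maximalIdeal R := by
      rw [← hψmem, (hker d).mpr (hd ▸ hsc)]
      exact zero_mem _
    obtain rfl : φ (c + d) = s := by rw [map_add, hd, add_sub_cancel]
    refine ⟨c + d, hφ ?_, ?_⟩
    · rwa [IsRoot.def, eval_map_apply, ← map_zero φ] at hs
    · rw [add_sub_right_comm]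
      exact add_mem hta hdmem

namespace ValuationSubring

variable {K : Type*} [Field K]

theorem mem_of_mem_maximalIdeal_of_le {A B : ValuationSubring K} (hAB : A ≤ B) {x : B}
    (hx : x ∈ maximalIdeal B) : (x : K) ∈ A := by
  by_contra hxA
  have hinv := hAB ((A.mem_or_inv_mem x).resolve_left hxA)
  have hx0 : (x : K) ≠ 0 := fun h ↦ hxA (h ▸ A.zero_mem)
  exact hx (.of_mul_eq_one ⟨_, hinv⟩ (Subtype.ext (mul_inv_cancel₀ hx0)))

/-- The image of a valuation subring `A ≤ B` in the residue field of `B`. -/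
noncomputable def residueImage (A B : ValuationSubring K) (hAB : A ≤ B) : ValuationSubring (ResidueField B) :=
  ofSubring ((residue B).comp (A.inclusion B hAB)).range fun y ↦ by
    obtain ⟨x, rfl⟩ := residue_surjective y
    obtain hx | hx := A.mem_or_inv_mem (x : K)
    · exact .inl ⟨⟨x, hx⟩, rfl⟩
    · by_cases hx0 : (x : K) = 0
      · exact .inl ⟨0, by rw [map_zero, show x = 0 from Subtype.ext hx0, map_zero]⟩
      · refine .inr ⟨⟨_, hx⟩, eq_inv_of_mul_eq_one_left ?_⟩
        rw [RingHom.comp_apply, ← map_mul, ← map_one (residue B)]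
        exact congrArg _ (Subtype.ext (inv_mul_cancel₀ hx0))

end ValuationSubring

/-- if `A ≤ B` are valuation subrings of `K`, then the maximal
ideal of `B` is contained in `A`, the image of `A` in the residue field of `B`
is a valuation subring `Ā`, and `A` is henselian iff both `B` and `Ā` are. -/
theorem stmt_1 {K : Type*} [Field K] (A B : ValuationSubring K) (hAB : A ≤ B) :
    (∀ x : B, x ∈ IsLocalRing.maximalIdeal B → (x : K) ∈ A) ∧
    ∃ Abar : ValuationSubring (IsLocalRing.ResidueField B),
      (Abar : Set (IsLocalRing.ResidueField B)) =
        {y | ∃ x : B, (x : K) ∈ A ∧ IsLocalRing.residue B x = y} ∧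
      (HenselianLocalRing A ↔ (HenselianLocalRing B ∧ HenselianLocalRing Abar)) := by
  refine ⟨fun x hx ↦ A.mem_of_mem_maximalIdeal_of_le hAB hx, A.residueImage B hAB, ?_, ?_⟩
  · ext y
    exact ⟨fun ⟨a, ha⟩ ↦ ⟨A.inclusion B hAB a, a.2, ha⟩, fun ⟨x, hx, hxy⟩ ↦ ⟨⟨x, hx⟩, hxy⟩⟩
  let φ : A →+* B := A.inclusion B hAB
  let ψ : A →+* A.residueImage B hAB := ((residue B).comp φ).rangeRestrict
  have hφ : ∀ s ∈ maximalIdeal B, ∃ r, φ r = s := fun s hs ↦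
    ⟨⟨s, ValuationSubring.mem_of_mem_maximalIdeal_of_le hAB hs⟩, rfl⟩
  have hψ : Function.Surjective ψ := ((residue B).comp φ).rangeRestrict_surjective
  constructor
  · intro _
    exact ⟨.of_maximalIdeal_le_range φ hφ, .of_maximalIdeal_le_range ψ fun s _ ↦ hψ s⟩
  · rintro ⟨_, _⟩
    refine .of_injective_of_surjective φ ψ (Subring.inclusion_injective hAB) hψ hφ fun r ↦ ?_
    rw [← residue_eq_zero_iff, Subtype.ext_iff]
    rfl
end

section
/- Let K be a field and let 𝒞 be a nonempty family of valuation subrings of K that is totally ordered by inclusion and such that each member of 𝒞 is a henselian local ring. Then the intersection ⋂ 𝒞 is a valuation subring of K and is a henselian local ring. -/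
open Polynomial

namespace ValuationSubring

variable {K : Type*} [Field K]

/-- The intersection of a chain of valuation subrings, as a valuation subring. -/
def chainInf (C : Set (ValuationSubring K)) (hC : ∀ A ∈ C, ∀ B ∈ C, A ≤ B ∨ B ≤ A) :
    ValuationSubring K :=
  ofSubring (⨅ A ∈ C, A.toSubring) fun x => by
    simp only [Subring.mem_iInf, mem_toSubring]
    by_contra! ⟨⟨A, hA, hxA⟩, B, hB, hxB⟩
    rcases hC A hA B hB with h | h
    · exact hxB (h ((A.mem_or_inv_mem x).resolve_left hxA))
    · exact hxA (h ((B.mem_or_inv_mem x).resolve_right hxB))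

variable {C : Set (ValuationSubring K)} {hC : ∀ A ∈ C, ∀ B ∈ C, A ≤ B ∨ B ≤ A}

theorem mem_chainInf {x : K} : x ∈ chainInf C hC ↔ ∀ A ∈ C, x ∈ A := by
  simp only [chainInf, mem_ofSubring, Subring.mem_iInf, mem_toSubring]

theorem chainInf_le {A : ValuationSubring K} (hA : A ∈ C) : chainInf C hC ≤ A :=
  fun _ hx => mem_chainInf.1 hx A hA

theorem exists_mem_nonunits_of_mem_nonunits_chainInf {x : K} (hx : x ≠ 0)
    (h : x ∈ (chainInf C hC).nonunits) : ∃ A ∈ C, x ∈ A.nonunits := by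
  have hinv := ((mem_nonunits_iff_or _).1 h).resolve_left hx
  rw [mem_chainInf] at hinv
  push Not at hinv
  obtain ⟨A, hA, hxA⟩ := hinv
  exact ⟨A, hA, (mem_nonunits_iff_or _).2 (.inr hxA)⟩

theorem henselianLocalRing_chainInf (hhens : ∀ A ∈ C, HenselianLocalRing A) :
    HenselianLocalRing (chainInf C hC) where
  is_henselian f hf a₀ h₀ h₁ := by
    by_cases hz : f.eval a₀ = 0
    · exact ⟨a₀, hz, by simp⟩
    obtain ⟨A, hA, hfA⟩ := exists_mem_nonunits_of_mem_nonunits_chainInf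
      (x := ((f.eval a₀ : chainInf C hC) : K)) (by simpa using hz)
      (coe_mem_nonunits_iff.2 h₀)
    have hle : chainInf C hC ≤ A := chainInf_le hA
    have := hhens A hA
    obtain ⟨a, ha, haa⟩ := HenselianLocalRing.is_henselian (f.map (inclusion _ A hle))
      (hf.map _) (inclusion _ A hle a₀)
      (by rw [eval_map, eval₂_hom]; exact coe_mem_nonunits_iff.1 hfA)
      (by rw [derivative_map, eval_map, eval₂_hom]; exact h₁.map _)
    have hnon : (a : K) - a₀ ∈ (chainInf C hC).nonunits :=
      nonunits_le_nonunits.2 hle (coe_mem_nonunits_iff.2 haa)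
    have hmem : (a : K) ∈ chainInf C hC := by
      simpa using (chainInf C hC).add_mem _ _ (nonunits_subset hnon) a₀.2
    refine ⟨⟨a, hmem⟩, ?_, coe_mem_nonunits_iff.1 hnon⟩
    exact IsRoot.of_map (f := inclusion _ A hle) ha (Set.inclusion_injective hle)

end ValuationSubring

/-- the intersection of a nonempty chain of henselian valuation
subrings of a field is a henselian valuation subring. -/
theorem stmt_2 {K : Type*} [Field K] (C : Set (ValuationSubring K))
    (hne : C.Nonempty)
    (hchain : ∀ A ∈ C, ∀ B ∈ C, A ≤ B ∨ B ≤ A)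
    (hhens : ∀ A ∈ C, HenselianLocalRing A) :
    ∃ O : ValuationSubring K,
      (O : Set K) = ⋂ A ∈ C, (A : Set K) ∧ HenselianLocalRing O := by
  refine ⟨.chainInf C hchain, ?_, ValuationSubring.henselianLocalRing_chainInf hhens⟩
  ext x
  simp [ValuationSubring.mem_chainInf]
end

section
/- Let K be a field and let O ⊆ O' be valuation subrings of K. If O is a henselian local ring, then O' is a henselian local ring. (Coarsenings of henselian valuation rings are henselian.) -/
open Polynomial IsLocalRing in
/-- Over a henselian local ring, `1 + Y + Y² q(Y)` has a root when all coefficients of `q` lie in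
the maximal ideal. -/
theorem HenselianLocalRing.exists_one_add_add_sq_mul_eval_eq_zero {R : Type*} [CommRing R]
    [HenselianLocalRing R] (q : R[X]) (hq : ∀ i, q.coeff i ∈ maximalIdeal R) :
    ∃ y : R, 1 + y + y ^ 2 * q.eval y = 0 := by
  have hr : q.reverse.map (residue R) = 0 := by
    ext i
    simpa [coeff_reverse, residue_eq_zero_iff] using hq _
  have hr0 : residue R (q.reverse.eval (-1)) = 0 := by
    rw [← eval_map_apply, hr, eval_zero]
  have hr1 : residue R (q.reverse.derivative.eval (-1)) = 0 := by
    rw [← eval_map_apply, ← derivative_map, hr, derivative_zero, eval_zero]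
  have hlow : (X ^ (q.natDegree + 1) + q.reverse : R[X]).degree < (q.natDegree + 2 : ℕ) := by
    refine lt_of_le_of_lt (degree_add_le _ _) (max_lt ?_ ?_)
    · exact lt_of_le_of_lt (degree_X_pow_le _) (by exact_mod_cast Nat.lt_succ_self _)
    · refine lt_of_le_of_lt degree_le_natDegree ?_
      exact_mod_cast lt_of_le_of_lt (reverse_natDegree_le q) (by lia)
  obtain ⟨z, hz, hz1⟩ := HenselianLocalRing.is_henselian
    (X ^ (q.natDegree + 2) + (X ^ (q.natDegree + 1) + q.reverse))
    (monic_X_pow_add (by simpa using hlow)) (-1)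
    (by
      rw [← residue_eq_zero_iff]
      simp only [eval_add, eval_pow, eval_X, map_add, hr0, map_pow, map_neg, map_one]
      ring)
    (by
      rw [← residue_ne_zero_iff_isUnit]
      simp only [derivative_X_pow, eval_add, eval_mul, eval_natCast, eval_pow, eval_X,
        map_add, hr1, map_mul, map_pow, map_neg, map_one, map_natCast]
      have : ((q.natDegree + 2 : ℕ) : ResidueField R) * (-1) ^ (q.natDegree + 2 - 1) +
          (((q.natDegree + 1 : ℕ) : ResidueField R) * (-1) ^ (q.natDegree + 1 - 1) + 0) =
          (-1) ^ (q.natDegree + 1) := by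
        simp only [Nat.add_sub_cancel, show q.natDegree + 2 - 1 = q.natDegree + 1 by lia]
        push_cast
        ring
      rw [this]
      exact pow_ne_zero _ (neg_ne_zero.mpr one_ne_zero))
  have hzu : IsUnit z := by
    rw [← residue_ne_zero_iff_isUnit]
    rw [← residue_eq_zero_iff, map_sub, sub_eq_zero] at hz1
    simp [hz1]
  obtain ⟨u, rfl⟩ := hzu
  let y : Rˣ := u⁻¹
  let : Invertible (y : R) := y.invertible
  have hinv : ⅟(y : R) = u := by simp [y]
  have hrev := eval₂_reverse_mul_pow (RingHom.id R) (y : R) q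
  rw [hinv] at hrev
  change q.reverse.eval _ * _ = q.eval _ at hrev
  have huy : (u : R) * y = 1 := by simp [y]
  refine ⟨y, ?_⟩
  rw [IsRoot, eval_add, eval_add, eval_pow, eval_pow, eval_X] at hz
  have h1 : (u : R) ^ (q.natDegree + 1) * (y : R) ^ (q.natDegree + 1) = 1 := by
    rw [← mul_pow, huy, one_pow]
  rw [← hrev]
  linear_combination (y : R) ^ (q.natDegree + 2) * hz -
    (u * y + y) * h1 - huy

open Polynomial in
/-- Second order Taylor expansion of a polynomial, with polynomial remainder. -/
theorem Polynomial.exists_eval_add_eq {R : Type*} [CommRing R] (f : R[X]) (a : R) :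
    ∃ g : R[X], ∀ x, f.eval (a + x) =
      f.eval a + f.derivative.eval a * x + g.eval x * x ^ 2 := by
  refine ⟨(taylor a f).divX.divX, fun x ↦ ?_⟩
  have h0 := congrArg (eval x) (divX_mul_X_add (taylor a f))
  have h1 := congrArg (eval x) (divX_mul_X_add (taylor a f).divX)
  simp only [eval_add, eval_mul, eval_X, eval_C, coeff_divX, zero_add, taylor_coeff_zero,
    taylor_coeff_one, taylor_eval] at h0 h1
  rw [add_comm a x, ← h0, ← h1]
  ring

open IsLocalRing in
/-- The maximal ideal of a coarsening of `O` is contained in `O`. -/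
theorem ValuationSubring.exists_inclusion_eq_of_mem_maximalIdeal {K : Type*} [Field K]
    {O O' : ValuationSubring K} (h : O ≤ O') {x : O'} (hx : x ∈ maximalIdeal O') :
    ∃ y : O, O.inclusion O' h y = x := by
  rcases O.mem_or_inv_mem (x : K) with hxO | hxO
  · exact ⟨⟨x, hxO⟩, rfl⟩
  · by_cases hx0 : (x : K) = 0
    · exact ⟨0, Subtype.ext hx0.symm⟩
    · exact absurd (IsUnit.of_mul_eq_one (⟨_, h hxO⟩ : O')
        (Subtype.ext (mul_inv_cancel₀ hx0))) hx

open Polynomial IsLocalRing in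
/-- a coarsening of a henselian valuation ring is henselian. -/
theorem stmt_3 {K : Type*} [Field K] (O O' : ValuationSubring K) (h : O ≤ O')
    (hhens : HenselianLocalRing O) : HenselianLocalRing O' := by
  refine ⟨fun f _ a hfa hf'a ↦ ?_⟩
  obtain ⟨g, hg⟩ := f.exists_eval_add_eq a
  obtain ⟨u, hu⟩ := hf'a
  set t : O' := f.eval a * ↑u⁻¹ with ht
  have htm : t ∈ maximalIdeal O' := Ideal.mul_mem_right _ _ hfa
  have htu : f.eval a = t * u := by simp [ht]
  let q : O'[X] := C (t * ↑u⁻¹) * g.comp (C t * X)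
  have hq (i : ℕ) : q.coeff i ∈ maximalIdeal O' := by
    rw [coeff_C_mul]
    exact Ideal.mul_mem_right _ _ (Ideal.mul_mem_right _ _ htm)
  obtain ⟨p, hp⟩ := (mem_lifts (f := O.inclusion O' h) q).mp <|
    (lifts_iff_coeff_lifts q).mpr fun i ↦
      ValuationSubring.exists_inclusion_eq_of_mem_maximalIdeal h (hq i)
  have hpm (i : ℕ) : p.coeff i ∈ maximalIdeal O := fun hunit ↦ by
    have := hunit.map (O.inclusion O' h)
    rw [← coeff_map, hp] at this
    exact hq i this
  obtain ⟨y, hy⟩ := HenselianLocalRing.exists_one_add_add_sq_mul_eval_eq_zero p hpm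
  set w : O' := O.inclusion O' h y with hw
  have hyw : 1 + w + w ^ 2 * q.eval w = 0 := by
    have := congrArg (O.inclusion O' h) hy
    rwa [map_add, map_add, map_mul, map_pow, map_one, map_zero, ← eval_map_apply, hp] at this
  refine ⟨a + t * w, ?_, by simpa using Ideal.mul_mem_right w _ htm⟩
  have huu : (u : O') * ↑u⁻¹ = 1 := u.mul_inv
  simp only [q, eval_mul, eval_C, eval_comp, eval_X] at hyw
  rw [IsRoot, hg, ← hu, htu]
  linear_combination t * u * hyw - t ^ 2 * w ^ 2 * g.eval (t * w) * huu
end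

section
/- Let K ⊆ L be a field extension with L algebraic over K, and let O₁ ⊆ O₂ be valuation subrings of L such that O₁ ∩ K = O₂ ∩ K. Then O₁ = O₂. (Distinct extensions of a valuation ring of K to an algebraic extension L are pairwise incomparable.) -/
/-- In a valued field, a finite sum with a strictly dominant term is nonzero. -/
theorem Valuation.sum_ne_zero_of_dominant {L Γ ι : Type*} [Field L]
    [LinearOrderedCommGroupWithZero Γ] (v : Valuation L Γ) (s : Finset ι) (f : ι → L) {n : ι}
    (hn : n ∈ s) (hf : f n ≠ 0) (hlt : ∀ i ∈ s, i ≠ n → v (f i) < v (f n)) :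
    ∑ i ∈ s, f i ≠ 0 := by
  classical
  intro hsum
  rw [← Finset.add_sum_erase s f hn] at hsum
  have hrest : v (∑ i ∈ s.erase n, f i) < v (f n) :=
    v.map_sum_lt ((v.ne_zero_iff).2 hf) fun i hi =>
      hlt i (Finset.mem_of_mem_erase hi) (Finset.ne_of_mem_erase hi)
  rw [eq_neg_of_add_eq_zero_left hsum, v.map_neg] at hrest
  exact hrest.false

/-- two comparable valuation subrings of an algebraic extension
`L/K` with the same restriction to `K` are equal. -/
theorem stmt_4 {K L : Type*} [Field K] [Field L] [Algebra K L]
    [Algebra.IsAlgebraic K L]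
    (O₁ O₂ : ValuationSubring L) (h : O₁ ≤ O₂)
    (hres : ∀ x : K, algebraMap K L x ∈ O₁ ↔ algebraMap K L x ∈ O₂) :
    O₁ = O₂ := by
  refine le_antisymm h fun x hx₂ => ?_
  by_contra hx₁
  have hx : 1 < O₁.valuation x := by
    rwa [← not_le, O₁.valuation_le_one_iff]
  have hx0 : x ≠ 0 := fun h0 => hx₁ (h0 ▸ O₁.zero_mem)
  obtain ⟨p, hp0, hp⟩ := Algebra.IsAlgebraic.isAlgebraic (R := K) x
  -- among the coefficients of maximal value, take the one of highest degree
  obtain ⟨n, hn, hmax⟩ := p.support.exists_max_image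
    (fun i => toLex (O₁.valuation (algebraMap K L (p.coeff i)), i))
    (Polynomial.support_nonempty.2 hp0)
  have hcoeff : ∀ i ∈ p.support, algebraMap K L (p.coeff i) ≠ 0 := fun i hi => by
    simpa using hi
  rw [Polynomial.aeval_eq_sum_range, ← Polynomial.sum_over_range' p (f := fun i a => a • x ^ i)
    (by simp) _ (Nat.lt_succ_self _), Polynomial.sum_def] at hp
  simp only [Algebra.smul_def] at hp
  refine O₁.valuation.sum_ne_zero_of_dominant p.support _ hn
    (mul_ne_zero (hcoeff n hn) (pow_ne_zero n hx0)) (fun i hi hin => ?_) hp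
  have hvn : 0 < O₁.valuation (algebraMap K L (p.coeff n)) :=
    zero_lt_iff.2 ((O₁.valuation.ne_zero_iff).2 (hcoeff n hn))
  have hle := hmax i hi
  rw [Prod.Lex.toLex_le_toLex] at hle
  rcases lt_or_gt_of_ne hin with hlt | hgt
  · have hv : O₁.valuation (algebraMap K L (p.coeff i)) ≤
        O₁.valuation (algebraMap K L (p.coeff n)) := hle.elim le_of_lt fun h => h.1.le
    simp only [map_mul, map_pow]
    exact mul_lt_mul_of_le_of_lt_of_nonneg_of_pos hv (pow_lt_pow_right₀ hx hlt) zero_le hvn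
  · have hv : O₁.valuation (algebraMap K L (p.coeff i)) <
        O₁.valuation (algebraMap K L (p.coeff n)) := hle.resolve_right fun h => by
      exact absurd h.2 (not_le.2 hgt)
    have hi0 := hcoeff i hi
    by_contra! hge
    have hvi := zero_lt_iff.2 ((O₁.valuation.ne_zero_iff).2 hi0)
    have hmem : algebraMap K L (p.coeff n) * x ^ n / (algebraMap K L (p.coeff i) * x ^ i) ∈ O₁ := by
      rw [← O₁.valuation_le_one_iff, map_div₀]
      exact div_le_one_of_le₀ hge zero_le
    have hmem₂ := O₂.mul_mem _ _ (h hmem) (pow_mem hx₂ (i - n))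
    have hq : algebraMap K L (p.coeff n) * x ^ n / (algebraMap K L (p.coeff i) * x ^ i) *
        x ^ (i - n) = algebraMap K L (p.coeff n / p.coeff i) := by
      rw [← Nat.sub_add_cancel hgt.le, pow_add, Nat.add_sub_cancel, map_div₀,
        Nat.sub_add_cancel hgt.le]
      field_simp
    rw [hq, ← hres, ← O₁.valuation_le_one_iff, map_div₀, map_div₀, div_le_one₀ hvi] at hmem₂
    exact absurd hv (not_lt.2 hmem₂)
end

section
/- Let K be a field and let O₁ and O₂ be valuation subrings of K that are incomparable, i.e. O₁ ⊄ O₂ and O₂ ⊄ O₁, with maximal ideals m₁ and m₂ respectively. Then the set O₁·O₂ := {x·y : x ∈ O₁, y ∈ O₂} is a valuation subring of K containing both O₁ and O₂, and moreover O₁·O₂ = {x·y : x ∈ m₁, y ∈ m₂}. -/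
namespace ValuationSubring

variable {K : Type*} [Field K]

theorem inv_mem_nonunits_of_notMem (A : ValuationSubring K) {x : K} (hx : x ∉ A) :
    x⁻¹ ∈ A.nonunits := by
  rw [mem_nonunits_iff, map_inv₀]
  rw [← A.valuation_le_one_iff, not_le] at hx
  exact inv_lt_one_of_one_lt₀ hx

theorem mul_mem_nonunits_of_mem (A : ValuationSubring K) {x y : K} (hx : x ∈ A)
    (hy : y ∈ A.nonunits) : x * y ∈ A.nonunits := by
  rw [mem_nonunits_iff] at hy ⊢
  rw [← A.valuation_le_one_iff] at hx
  rw [map_mul]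
  exact (mul_le_of_le_one_left' hx).trans_lt hy

theorem exists_eq_mul_or_eq_mul (A : ValuationSubring K) (x y : K) :
    (∃ a ∈ A, y = a * x) ∨ ∃ a ∈ A, x = a * y := by
  rcases le_total (A.valuation y) (A.valuation x) with h | h
  · obtain ⟨a, ha⟩ := (A.valuation_le_iff y x).1 h
    exact .inl ⟨a, a.2, ha.symm⟩
  · obtain ⟨a, ha⟩ := (A.valuation_le_iff x y).1 h
    exact .inr ⟨a, a.2, ha.symm⟩

theorem exists_add_eq_mul (A B : ValuationSubring K) {a b : K} (ha : a ∈ A) (hb : b ∈ B) :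
    ∃ x ∈ A, ∃ y ∈ B, a + b = x * y := by
  by_cases haB : a ∈ B
  · exact ⟨1, A.one_mem, a + b, B.add_mem _ _ haB hb, (one_mul _).symm⟩
  · have ha0 : a ≠ 0 := fun h => haB (h ▸ B.zero_mem)
    have hinv : a⁻¹ ∈ B := (B.mem_or_inv_mem a).resolve_left haB
    refine ⟨a, ha, 1 + b * a⁻¹, B.add_mem _ _ B.one_mem (B.mul_mem _ _ hb hinv), ?_⟩
    field_simp

theorem exists_one_add_mul_eq_mul (A B : ValuationSubring K) {a b : K} (ha : a ∈ A)
    (hb : b ∈ B) : ∃ x ∈ A, ∃ y ∈ B, 1 + a * b = x * y := by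
  by_cases haB : a ∈ B
  · exact ⟨1, A.one_mem, 1 + a * b, B.add_mem _ _ B.one_mem (B.mul_mem _ _ haB hb),
      (one_mul _).symm⟩
  · have ha0 : a ≠ 0 := fun h => haB (h ▸ B.zero_mem)
    have hinv : a⁻¹ ∈ B := (B.mem_or_inv_mem a).resolve_left haB
    refine ⟨a, ha, a⁻¹ + b, B.add_mem _ _ hinv hb, ?_⟩
    field_simp

theorem exists_mul_add_mul_eq_mul (A B : ValuationSubring K) {x₁ x₂ y₁ y₂ : K}
    (hx₁ : x₁ ∈ A) (hx₂ : x₂ ∈ A) (hy₁ : y₁ ∈ B) (hy₂ : y₂ ∈ B) :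
    ∃ x ∈ A, ∃ y ∈ B, x₁ * y₁ + x₂ * y₂ = x * y := by
  rcases A.exists_eq_mul_or_eq_mul x₁ x₂ with ⟨a, ha, rfl⟩ | ⟨a, ha, rfl⟩ <;>
    rcases B.exists_eq_mul_or_eq_mul y₁ y₂ with ⟨b, hb, rfl⟩ | ⟨b, hb, rfl⟩
  · obtain ⟨u, hu, v, hv, h⟩ := A.exists_one_add_mul_eq_mul B ha hb
    exact ⟨x₁ * u, A.mul_mem _ _ hx₁ hu, y₁ * v, B.mul_mem _ _ hy₁ hv,
      by linear_combination x₁ * y₁ * h⟩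
  · obtain ⟨u, hu, v, hv, h⟩ := A.exists_add_eq_mul B ha hb
    exact ⟨x₁ * u, A.mul_mem _ _ hx₁ hu, y₂ * v, B.mul_mem _ _ hy₂ hv,
      by linear_combination x₁ * y₂ * h⟩
  · obtain ⟨u, hu, v, hv, h⟩ := A.exists_add_eq_mul B ha hb
    exact ⟨x₂ * u, A.mul_mem _ _ hx₂ hu, y₁ * v, B.mul_mem _ _ hy₁ hv,
      by linear_combination x₂ * y₁ * h⟩
  · obtain ⟨u, hu, v, hv, h⟩ := A.exists_one_add_mul_eq_mul B ha hb
    exact ⟨x₂ * u, A.mul_mem _ _ hx₂ hu, y₂ * v, B.mul_mem _ _ hy₂ hv,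
      by linear_combination x₂ * y₂ * h⟩

/-- The valuation subring of all products `x * y` with `x ∈ A` and `y ∈ B`. -/
def prodSubring (A B : ValuationSubring K) : ValuationSubring K where
  carrier := {z | ∃ x ∈ A, ∃ y ∈ B, z = x * y}
  mul_mem' := by
    rintro _ _ ⟨x₁, hx₁, y₁, hy₁, rfl⟩ ⟨x₂, hx₂, y₂, hy₂, rfl⟩
    exact ⟨x₁ * x₂, A.mul_mem _ _ hx₁ hx₂, y₁ * y₂, B.mul_mem _ _ hy₁ hy₂,
      mul_mul_mul_comm _ _ _ _⟩
  one_mem' := ⟨1, A.one_mem, 1, B.one_mem, (one_mul 1).symm⟩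
  add_mem' := by
    rintro _ _ ⟨x₁, hx₁, y₁, hy₁, rfl⟩ ⟨x₂, hx₂, y₂, hy₂, rfl⟩
    exact A.exists_mul_add_mul_eq_mul B hx₁ hx₂ hy₁ hy₂
  zero_mem' := ⟨0, A.zero_mem, 0, B.zero_mem, (zero_mul 0).symm⟩
  neg_mem' := by
    rintro _ ⟨x, hx, y, hy, rfl⟩
    exact ⟨-x, A.neg_mem _ hx, y, hy, (neg_mul x y).symm⟩
  mem_or_inv_mem' z := (A.mem_or_inv_mem z).imp
    (fun h => ⟨z, h, 1, B.one_mem, (mul_one z).symm⟩)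
    (fun h => ⟨z⁻¹, h, 1, B.one_mem, (mul_one z⁻¹).symm⟩)

theorem exists_mem_nonunits_inv_mem_nonunits {A B : ValuationSubring K} (hAB : ¬ A ≤ B)
    (hBA : ¬ B ≤ A) : ∃ t : K, t ≠ 0 ∧ t ∈ A.nonunits ∧ t⁻¹ ∈ B.nonunits := by
  obtain ⟨c, hcA, hcB⟩ := SetLike.not_le_iff_exists.1 hAB
  obtain ⟨d, hdB, hdA⟩ := SetLike.not_le_iff_exists.1 hBA
  have hc : c ≠ 0 := fun h => hcB (h ▸ B.zero_mem)
  have hd : d ≠ 0 := fun h => hdA (h ▸ A.zero_mem)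
  refine ⟨c * d⁻¹, mul_ne_zero hc (inv_ne_zero hd),
    A.mul_mem_nonunits_of_mem hcA (A.inv_mem_nonunits_of_notMem hdA), ?_⟩
  rw [mul_inv_rev, inv_inv]
  exact B.mul_mem_nonunits_of_mem hdB (B.inv_mem_nonunits_of_notMem hcB)

end ValuationSubring

/-- the join of two incomparable valuation subrings `O₁, O₂` of a
field `K` is the valuation subring `{x·y : x ∈ O₁, y ∈ O₂}`, which also equals
`{x·y : x ∈ m₁, y ∈ m₂}` where `mᵢ` is the maximal ideal of `Oᵢ` (here realized
as the set `Oᵢ.nonunits` of elements of `K` of `Oᵢ`-valuation `< 1`). -/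
theorem stmt_6 {K : Type*} [Field K] (O₁ O₂ : ValuationSubring K)
    (h₁ : ¬ O₁ ≤ O₂) (h₂ : ¬ O₂ ≤ O₁) :
    ∃ O : ValuationSubring K,
      (O : Set K) = {z : K | ∃ x ∈ O₁, ∃ y ∈ O₂, z = x * y} ∧
      O₁ ≤ O ∧ O₂ ≤ O ∧
      (O : Set K) = {z : K | ∃ x ∈ O₁.nonunits, ∃ y ∈ O₂.nonunits, z = x * y} := by
  refine ⟨O₁.prodSubring O₂, rfl, fun x hx => ⟨x, hx, 1, O₂.one_mem, (mul_one x).symm⟩,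
    fun y hy => ⟨1, O₁.one_mem, y, hy, (one_mul y).symm⟩, Set.Subset.antisymm ?_ ?_⟩
  · rintro _ ⟨x, hx, y, hy, rfl⟩
    obtain ⟨t, ht, ht₁, ht₂⟩ := ValuationSubring.exists_mem_nonunits_inv_mem_nonunits h₁ h₂
    refine ⟨x * t, O₁.mul_mem_nonunits_of_mem hx ht₁, y * t⁻¹,
      O₂.mul_mem_nonunits_of_mem hy ht₂, ?_⟩
    field_simp
  · rintro _ ⟨x, hx, y, hy, rfl⟩
    exact ⟨x, O₁.nonunits_subset hx, y, O₂.nonunits_subset hy, rfl⟩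
end

section
/- Let K be a field, O a valuation subring of K with maximal ideal m, and n ≥ 1 a natural number. Let U := 1 + m = {u ∈ Kˣ : u - 1 ∈ m}, a subgroup of the multiplicative group Kˣ. If the quotient group Kˣ/(Kˣ)ⁿ is finite, then the quotient group U/Uⁿ is finite, where Uⁿ = {uⁿ : u ∈ U}. -/
/-- If a subgroup `U` of a commutative group has finite index in its preimage under the `n`-th power
map, and the `n`-th powers have finite index in the ambient group, then they do so in `U`. -/
theorem Subgroup.finite_quotient_range_powMonoidHom {G : Type*} [CommGroup G] (U : Subgroup G)
    (n : ℕ) (hG : (powMonoidHom n : G →* G).range.index ≠ 0)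
    (hU : U.relIndex (U.comap (powMonoidHom n)) ≠ 0) :
    Finite (U ⧸ (powMonoidHom n : U →* U).range) := by
  have hrange : (powMonoidHom n : U →* U).range = (U.map (powMonoidHom n)).subgroupOf U := by
    ext x
    simp [Subgroup.mem_subgroupOf, Subtype.ext_iff]
  have hle : U ≤ U.comap (powMonoidHom n) := fun x hx => U.pow_mem hx n
  have h₁ : (U.map (powMonoidHom n)).relIndex ((U.comap (powMonoidHom n)).map (powMonoidHom n))
      ≠ 0 := by
    rw [← Subgroup.relIndex_comap, Subgroup.comap_map_eq]
    exact fun h => hU (Subgroup.relIndex_eq_zero_of_le_left le_sup_left h)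
  have h₂ : ((U.comap (powMonoidHom n)).map (powMonoidHom n)).relIndex U ≠ 0 := by
    rw [Subgroup.map_comap_eq, inf_comm, Subgroup.inf_relIndex_left]
    exact fun h => hG (Nat.eq_zero_of_zero_dvd (h ▸ Subgroup.relIndex_dvd_index_of_normal _ _))
  have h : ((powMonoidHom n : U →* U).range).index ≠ 0 := by
    rw [hrange]
    change (U.map (powMonoidHom n)).relIndex U ≠ 0
    rw [← Subgroup.relIndex_mul_relIndex _ _ _ (Subgroup.map_mono hle) (Subgroup.map_comap_le _ _)]
    exact mul_ne_zero h₁ h₂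
  exact Nat.finite_of_card_ne_zero h

/-- The principal units have finite index in the group of elements whose `n`-th power is a
principal unit, as the quotient embeds in the `n`-th roots of unity of the residue field. -/
theorem ValuationSubring.principalUnitGroup_relIndex_comap_powMonoidHom_ne_zero {K : Type*}
    [Field K] (O : ValuationSubring K) {n : ℕ} (hn : n ≠ 0) :
    O.principalUnitGroup.relIndex (O.principalUnitGroup.comap (powMonoidHom n)) ≠ 0 := by
  have : NeZero n := ⟨hn⟩
  set V := O.principalUnitGroup.comap (powMonoidHom n)
  have hV : V ≤ O.unitGroup := by
    intro x hx
    have h := O.principal_units_le_units (Subgroup.mem_comap.1 hx)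
    rw [O.mem_unitGroup_iff] at h ⊢
    simpa [hn] using h
  rw [← Subgroup.relIndex_subgroupOf hV, Subgroup.subgroupOf, ← O.ker_unitGroupToResidueFieldUnits,
    Subgroup.relIndex_ker]
  have hle : (V.subgroupOf O.unitGroup).map O.unitGroupToResidueFieldUnits ≤
      rootsOfUnity n (IsLocalRing.ResidueField O) := by
    rintro _ ⟨x, hx, rfl⟩
    rw [mem_rootsOfUnity, ← map_pow, ← MonoidHom.mem_ker, O.ker_unitGroupToResidueFieldUnits]
    exact hx
  have : Finite ((V.subgroupOf O.unitGroup).map O.unitGroupToResidueFieldUnits) :=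
    Finite.of_injective _ (Subgroup.inclusion_injective hle)
  exact Nat.card_pos.ne'

/-- if `Kˣ/(Kˣ)ⁿ` is finite, then so is `U/Uⁿ`, where
`U = 1 + m` is the group of principal units of a valuation subring `O`
of `K` (Mathlib's `O.principalUnitGroup`, the units `u` with `u - 1 ∈ m`). -/
theorem stmt_8 {K : Type*} [Field K] (O : ValuationSubring K) (n : ℕ)
    (hn : 1 ≤ n)
    (hfin : Finite (Kˣ ⧸ (powMonoidHom n : Kˣ →* Kˣ).range)) :
    Finite (O.principalUnitGroup ⧸
      (powMonoidHom n : O.principalUnitGroup →* O.principalUnitGroup).range) := by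
  exact O.principalUnitGroup.finite_quotient_range_powMonoidHom n Nat.card_pos.ne'
    (O.principalUnitGroup_relIndex_comap_powMonoidHom_ne_zero (by lia))
end

section
/- Let K be a field, O a valuation subring of K with maximal ideal m, and p a prime number with p ∈ m (so the residue field O/m has characteristic p). Suppose m is a nonzero principal ideal of O. If the quotient group Kˣ/(Kˣ)ᵖ is finite, then the residue field O/m is finite. -/
open IsLocalRing in
theorem IsLocalRing.pow_sub_one_mem_maximalIdeal_sq {R : Type*} [CommRing R] [IsLocalRing R]
    {p : ℕ} (hp : p.Prime) (hpm : (p : R) ∈ maximalIdeal R) {x : R}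
    (hx : x ^ p - 1 ∈ maximalIdeal R) : x ^ p - 1 ∈ maximalIdeal R ^ 2 := by
  have hp0 : (p : ResidueField R) = 0 := by
    rw [← map_natCast (residue R), residue_eq_zero_iff]
    exact hpm
  have : Fact p.Prime := ⟨hp⟩
  have : CharP (ResidueField R) p := (CharP.charP_iff_prime_eq_zero hp).2 hp0
  have hx1 : residue R x = 1 := by
    rw [← residue_eq_zero_iff, map_sub, map_pow, map_one, sub_eq_zero] at hx
    exact frobenius_inj (ResidueField R) p (by simpa [frobenius_def] using hx)
  rw [← geom_sum_mul, sq]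
  refine Ideal.mul_mem_mul ?_ ?_
  · rw [← residue_eq_zero_iff]
    simp [hx1]
  · rw [← residue_eq_zero_iff]
    simp [hx1]

/-- if `O` is a valuation subring of `K`, `p` a prime lying in the
maximal ideal `m` of `O`, `m` is a nonzero principal ideal, and `Kˣ/(Kˣ)ᵖ` is
finite, then the residue field `O/m` is finite. -/
theorem stmt_9 {K : Type*} [Field K] (O : ValuationSubring K) (p : ℕ)
    (hp : p.Prime) (hpm : ((p : K)) ∈ O.nonunits)
    (hprinc : ∃ π : O, π ≠ 0 ∧ IsLocalRing.maximalIdeal O = Ideal.span {π})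
    (hfin : Finite (Kˣ ⧸ (powMonoidHom p : Kˣ →* Kˣ).range)) :
    Finite (IsLocalRing.ResidueField O) := by
  obtain ⟨π, hπ0, hπ⟩ := hprinc
  have hpO : (p : O) ∈ IsLocalRing.maximalIdeal O := by
    rw [ValuationSubring.valuation_lt_one_iff]
    simpa using (ValuationSubring.mem_nonunits_iff O).1 hpm
  have hπm : π ∈ IsLocalRing.maximalIdeal O := hπ ▸ Ideal.mem_span_singleton_self π
  have hunit (a : O) : IsUnit (1 + π * a) := by
    by_contra h
    have h1 := (IsLocalRing.maximalIdeal O).sub_mem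
      ((IsLocalRing.mem_maximalIdeal _).2 h) (Ideal.mul_mem_right a _ hπm)
    rw [add_sub_cancel_right] at h1
    exact (IsLocalRing.mem_maximalIdeal _).1 h1 isUnit_one
  choose U hU using hunit
  obtain ⟨s, hs⟩ := (IsLocalRing.residue_surjective (R := O)).hasRightInverse
  refine Finite.of_injective
    (fun r => (QuotientGroup.mk (Units.map (algebraMap O K).toMonoidHom (U (s r))) :
      Kˣ ⧸ (powMonoidHom p : Kˣ →* Kˣ).range)) fun r r' h => ?_
  obtain ⟨u, hu⟩ := QuotientGroup.eq.1 h
  rw [← map_inv, ← map_mul] at hu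
  replace hu : (u : K) ^ p = algebraMap O K ((U (s r))⁻¹ * U (s r') : Oˣ) := by
    exact congrArg Units.val hu
  obtain ⟨x, hx⟩ := IsIntegrallyClosed.exists_algebraMap_eq_of_isIntegral_pow (R := O) hp.pos
    (hu ▸ isIntegral_algebraMap)
  rw [← hx, ← map_pow] at hu
  have hxp := IsFractionRing.injective O K hu
  have key : x ^ p - 1 = ↑(U (s r))⁻¹ * (π * (s r' - s r)) := by
    have h1 : (↑(U (s r))⁻¹ : O) * (1 + π * s r) = 1 := by rw [← hU, Units.inv_mul]
    rw [hxp, Units.val_mul, hU (s r')]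
    linear_combination h1
  have hsq := IsLocalRing.pow_sub_one_mem_maximalIdeal_sq hp hpO (x := x)
    (key ▸ Ideal.mul_mem_left _ _ (Ideal.mul_mem_right _ _ hπm))
  rw [key, Ideal.unit_mul_mem_iff_mem _ (Units.isUnit _), hπ, Ideal.span_singleton_pow,
    Ideal.mem_span_singleton, sq, mul_dvd_mul_iff_left hπ0, ← Ideal.mem_span_singleton, ← hπ,
    ← IsLocalRing.residue_eq_zero_iff, map_sub, hs, hs, sub_eq_zero] at hsq
  exact hsq.symm
end

section
/- Let X be a Hausdorff topological space and S ⊆ X. Then the cardinality of the topological closure of S is at most 2^(2^|S|), where |S| is the cardinality of S. (Every point of the closure of S is the limit of an ultrafilter concentrated on S, limits of ultrafilters in a Hausdorff space are unique, and there are at most 2^(2^|S|) ultrafilters on S.) -/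
/-- In a Hausdorff space, a point of the closure of `S` is determined by the trace on `S` of its
neighborhood filter. -/
theorem injective_comap_nhds_closure {X : Type*} [TopologicalSpace X] [T2Space X] (S : Set X) :
    Function.Injective fun x : closure S => Filter.comap ((↑) : S → X) (nhds (x : X)) := by
  intro x y hxy
  have : (Filter.comap ((↑) : S → X) (nhds (x : X))).NeBot :=
    mem_closure_iff_comap_neBot.1 x.2
  have hx : Filter.Tendsto ((↑) : S → X) (Filter.comap (↑) (nhds (x : X))) (nhds (x : X)) :=
    Filter.tendsto_comap
  have hy : Filter.Tendsto ((↑) : S → X) (Filter.comap (↑) (nhds (x : X))) (nhds (y : X)) :=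
    Filter.tendsto_iff_comap.2 hxy.le
  exact Subtype.ext (tendsto_nhds_unique hx hy)

/-- in a Hausdorff space, the closure of a set `S` has
cardinality at most `2 ^ (2 ^ |S|)`. -/
theorem stmt_14 {X : Type*} [TopologicalSpace X] [T2Space X] (S : Set X) :
    Cardinal.mk (closure S) ≤ (2 : Cardinal) ^ ((2 : Cardinal) ^ Cardinal.mk S) := by
  rw [← Cardinal.mk_set, ← Cardinal.mk_set]
  have sets_inj : Function.Injective (Filter.sets : Filter S → Set (Set S)) :=
    fun _ _ => Filter.filter_eq
  exact Cardinal.mk_le_of_injective (sets_inj.comp (injective_comap_nhds_closure S))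
end
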